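/- arXiv:1111.5044 — 2 statements merged into one kernel-verified Lean document; each statement's English description precedes it below -/
import Mathlib

section
/- Let V be a real inner product space and let Θ : V → End(V) be a linear map such that the trilinear form (x, y, z) ↦ ⟪Θ_x y, z⟫ is alternating, and such that Θ is infinitesimally invariant: Θ_{Θ_z x} = Θ_z ∘ Θ_x - Θ_x ∘ Θ_z for all x, z ∈ V. Then the bracket [x, y] := Θ_x y makes V into a Lie algebra, and the inner product is invariant for this bracket: ⟪[x,y], z⟫ = -⟪y, [x,z]⟫ for all x, y, z ∈ V. -/
open scoped RealInnerProductSpace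

/-- If `Θ : V → End V` is linear, `⟪Θ_x y, z⟫` is a 3-form, and `Θ` is infinitesimally
invariant (`Θ_{Θ_z x} = [Θ_z, Θ_x]`), then `[x, y] := Θ_x y` makes `V` a Lie algebra
(the bracket is antisymmetric and satisfies the Jacobi identity) for which the inner
product is invariant. -/
theorem lieAlgebra_from_symmetric_skewTorsion
    {V : Type*} [NormedAddCommGroup V] [InnerProductSpace ℝ V]
    (Θ : V →ₗ[ℝ] Module.End ℝ V)
    (hskew₁ : ∀ x y z : V, ⟪Θ x y, z⟫ = -⟪Θ y x, z⟫)
    (hskew₂ : ∀ x y z : V, ⟪Θ x y, z⟫ = -⟪Θ x z, y⟫)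
    (hinv : ∀ z x : V, Θ (Θ z x) = Θ z ∘ₗ Θ x - Θ x ∘ₗ Θ z) :
    (∀ x : V, Θ x x = 0) ∧
    (∀ x y : V, Θ x y = -Θ y x) ∧
    (∀ x y z : V, Θ x (Θ y z) = Θ (Θ x y) z + Θ y (Θ x z)) ∧
    (∀ x y z : V, ⟪Θ x y, z⟫ = -⟪y, Θ x z⟫) := by
  have hanti (x y : V) : Θ x y = -Θ y x :=
    ext_inner_right ℝ fun z => by rw [inner_neg_left, hskew₁]
  refine ⟨fun x => ext_inner_right ℝ fun z => ?_, hanti, fun x y z => ?_, fun x y z => ?_⟩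
  · rw [inner_zero_left]
    linarith [hskew₁ x x z]
  · rw [hinv]
    simp
  · rw [hskew₂, real_inner_comm]
end

section
/- Let n ≥ 2, let U ⊆ ℝⁿ be open and connected, let f : U → ℝ be differentiable, and let λ be a nonzero real number. Let V be a real vector space and let A, B be linear endomorphisms of V such that A, B and the commutator ⁅A,B⁆ = A∘B - B∘A are linearly independent. Fix indices i ≠ j in {1, …, n}, and suppose that for every p ∈ U, (f(p)² - 1/λ²) • ⁅A,B⁆ + (∂f/∂x_j)(p) • A - (∂f/∂x_i)(p) • B = 0. Then f is constant on U, equal to 1/λ or to -1/λ. -/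
/-- If `f` is differentiable on an open connected `U ⊆ ℝⁿ`, `λ ≠ 0`, and `A`, `B`,
`⁅A,B⁆` are linearly independent endomorphisms with
`(f² - 1/λ²) • ⁅A,B⁆ + (∂f/∂xⱼ) • A - (∂f/∂xᵢ) • B = 0` on `U`, then `f` is constant
on `U`, equal to `1/λ` or to `-1/λ`. -/
theorem flat_pde_forces_constant
    {n : ℕ} (hn : 2 ≤ n) {U : Set (Fin n → ℝ)} (hUopen : IsOpen U)
    (hUconn : IsConnected U)
    (f : (Fin n → ℝ) → ℝ) (hf : ∀ p ∈ U, DifferentiableAt ℝ f p)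
    (lam : ℝ) (hlam : lam ≠ 0)
    {V : Type*} [AddCommGroup V] [Module ℝ V]
    (A B : Module.End ℝ V) (hAB : LinearIndependent ℝ ![A, B, ⁅A, B⁆])
    (i j : Fin n) (hij : i ≠ j)
    (hPDE : ∀ p ∈ U,
      (f p ^ 2 - 1 / lam ^ 2) • ⁅A, B⁆
        + (fderiv ℝ f p (Pi.single j 1)) • A
        - (fderiv ℝ f p (Pi.single i 1)) • B = 0) :
    (∀ p ∈ U, f p = 1 / lam) ∨ (∀ p ∈ U, f p = -(1 / lam)) := by
  have hsq : Set.EqOn (f ^ 2) ((fun _ => 1 / lam) ^ 2) U := by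
    intro p hp
    have hcoeff := Fintype.linearIndependent_iff.mp hAB
      ![fderiv ℝ f p (Pi.single j 1), -fderiv ℝ f p (Pi.single i 1), f p ^ 2 - 1 / lam ^ 2]
      (by
        rw [← hPDE p hp]
        simp only [Fin.sum_univ_three, Matrix.cons_val]
        module) 2
    simp only [Matrix.cons_val] at hcoeff
    simp only [Pi.pow_apply, one_div, inv_pow] at hcoeff ⊢
    exact sub_eq_zero.mp hcoeff
  have hcont : ContinuousOn f U := fun p hp => (hf p hp).continuousAt.continuousWithinAt
  exact hUconn.isPreconnected.eq_or_eq_neg_of_sq_eq hcont continuousOn_const hsq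
    fun _ => one_div_ne_zero hlam
end
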